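/- (Zero-one law at infinity.) There exists a constant κ′₂ ∈ [0, ∞] (possibly 0 or ∞) such that, almost surely, liminf_{t → ∞} [ sup_{0 ≤ s ≤ t} |Y(s)| ] · (ln ln t)^{β} / t^{H+θ} = κ′₂. -/

import Mathlib

open MeasureTheory ProbabilityTheory Real Set Filter

/-- A process is a centered Gaussian process if every finite linear combination of its
values has a centered Gaussian distribution. -/
def IsCenteredGaussianProcess {Ω : Type*} [MeasurableSpace Ω] (P : Measure Ω)
    (X : ℝ → Ω → ℝ) : Prop :=
  ∀ (n : ℕ) (t : Fin n → ℝ) (c : Fin n → ℝ), ∃ v : NNReal,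
    P.map (fun ω => ∑ i, c i * X (t i) ω) = ProbabilityTheory.gaussianReal 0 v

/-- The covariance function of the generalized fractional Brownian motion:
`E[X s X t] = ∫_ℝ ((s−u)₊^α − (−u)₊^α)((t−u)₊^α − (−u)₊^α)|u|^{−γ} du`. -/
noncomputable def gfbmCov (α γ s t : ℝ) : ℝ :=
  ∫ u : ℝ, ((max (s - u) 0) ^ α - (max (-u) 0) ^ α) *
    ((max (t - u) 0) ^ α - (max (-u) 0) ^ α) * |u| ^ (-γ)

/-- `X` is a generalized fractional Brownian motion with parameters `(α, γ)` under `P`. -/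
def IsGFBM {Ω : Type*} [MeasurableSpace Ω] (P : Measure Ω) (α γ : ℝ)
    (X : ℝ → Ω → ℝ) : Prop :=
  IsCenteredGaussianProcess P X ∧
  (∀ ω, ContinuousOn (fun t => X t ω) (Set.Ici 0)) ∧
  (∀ ω, X 0 ω = 0) ∧
  (∀ s t : ℝ, 0 ≤ s → 0 ≤ t → ∫ ω, X s ω * X t ω ∂P = gfbmCov α γ s t)

/-- The fractional integral `Y(t) = (1/Γ(θ)) ∫₀^t (t−u)^{θ−1} X(u) du` of a process `X`. -/
noncomputable def fracInt {Ω : Type*} (θ : ℝ) (X : ℝ → Ω → ℝ) (t : ℝ) (ω : Ω) : ℝ :=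
  (Real.Gamma θ)⁻¹ * ∫ u in (0:ℝ)..t, (t - u) ^ (θ - 1) * X u ω

/-- The running maximum `M(t) = sup_{0 ≤ s ≤ t} |Y(s)|`. -/
noncomputable def runSup {Ω : Type*} (Y : ℝ → Ω → ℝ) (t : ℝ) (ω : Ω) : ℝ :=
  ⨆ s : Set.Icc (0:ℝ) t, |Y s.1 ω|

/-- The small ball function `φ(ε) = P(M(1) ≤ ε)`. -/
noncomputable def smallBall {Ω : Type*} [MeasurableSpace Ω] (P : Measure Ω)
    (Y : ℝ → Ω → ℝ) (ε : ℝ) : ℝ :=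
  (P {ω | runSup Y 1 ω ≤ ε}).toReal

section

open scoped Topology NNReal ENNReal

/-- The `L²` kernel of the generalized fractional Brownian motion. -/
noncomputable def gfbmKernel (α γ t u : ℝ) : ℝ :=
  ((max (t - u) 0) ^ α - (max (-u) 0) ^ α) * |u| ^ (-γ / 2)

lemma gfbmCov_eq_integral_kernel (α γ s t : ℝ) :
    gfbmCov α γ s t = ∫ u, gfbmKernel α γ s u * gfbmKernel α γ t u := by
  unfold gfbmCov gfbmKernel
  congr 1
  ext u
  have h : |u| ^ (-γ) = |u| ^ (-γ / 2) * |u| ^ (-γ / 2) := by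
    rw [← sq, ← Real.rpow_mul_natCast (abs_nonneg u)]
    congr 1
    push_cast
    ring
  rw [h]
  ring

lemma gfbmCov_comm (α γ s t : ℝ) : gfbmCov α γ s t = gfbmCov α γ t s := by
  simp only [gfbmCov_eq_integral_kernel, mul_comm]

@[fun_prop]
lemma measurable_gfbmKernel (α γ t : ℝ) : Measurable (gfbmKernel α γ t) := by
  unfold gfbmKernel
  fun_prop

lemma gfbmKernel_mul (α γ t u : ℝ) {c : ℝ} (hc : 0 < c) :
    gfbmKernel α γ (c * t) (c * u) = c ^ (α - γ / 2) * gfbmKernel α γ t u := by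
  have h1 : max (c * t - c * u) 0 = c * max (t - u) 0 := by
    rw [← mul_sub, mul_max_of_nonneg _ _ hc.le, mul_zero]
  have h2 : max (-(c * u)) 0 = c * max (-u) 0 := by
    rw [← mul_neg, mul_max_of_nonneg _ _ hc.le, mul_zero]
  unfold gfbmKernel
  rw [h1, h2, abs_mul, abs_of_pos hc, Real.mul_rpow hc.le (le_max_right _ _),
    Real.mul_rpow hc.le (le_max_right _ _), Real.mul_rpow hc.le (abs_nonneg _),
    sub_eq_add_neg α, Real.rpow_add hc, neg_div]
  ring

lemma gfbmKernel_mul_left (α γ t u : ℝ) {c : ℝ} (hc : 0 < c) :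
    gfbmKernel α γ (c * t) u = c ^ (α - γ / 2) * gfbmKernel α γ t (u / c) := by
  rw [← gfbmKernel_mul α γ t _ hc, mul_div_cancel₀ _ hc.ne']

lemma gfbmCov_mul (α γ s t : ℝ) {c : ℝ} (hc : 0 < c) :
    gfbmCov α γ (c * s) (c * t) = c ^ (2 * (α - γ / 2 + 1 / 2)) * gfbmCov α γ s t := by
  simp only [gfbmCov_eq_integral_kernel, gfbmKernel_mul_left α γ _ _ hc]
  have h := Measure.integral_comp_div
    (fun u => gfbmKernel α γ s u * gfbmKernel α γ t u) c
  have h' : ∀ u, c ^ (α - γ / 2) * gfbmKernel α γ s (u / c) *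
      (c ^ (α - γ / 2) * gfbmKernel α γ t (u / c)) =
      (c ^ (α - γ / 2) * c ^ (α - γ / 2)) *
        (gfbmKernel α γ s (u / c) * gfbmKernel α γ t (u / c)) := fun u => by ring
  simp only [h']
  rw [integral_const_mul, h, abs_of_pos hc, smul_eq_mul,
    show 2 * (α - γ / 2 + 1 / 2) = (α - γ / 2 + (α - γ / 2)) + 1 by ring, Real.rpow_add hc,
    Real.rpow_add hc, Real.rpow_one]
  ring

/-- Cauchy-Schwarz for the square-integrable functions on a set. -/
lemma abs_setIntegral_mul_le {f g : ℝ → ℝ} (hf : MemLp f 2) (hg : MemLp g 2) (s : Set ℝ) :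
    |∫ u in s, f u * g u| ≤ √(∫ u in s, f u ^ 2) * √(∫ u in s, g u ^ 2) := by
  have h := integral_mul_norm_le_Lp_mul_Lq (μ := volume.restrict s) (f := f) (g := g)
    Real.HolderConjugate.two_two (by simpa using hf.restrict s) (by simpa using hg.restrict s)
  simp only [Real.sqrt_eq_rpow]
  calc |∫ u in s, f u * g u| ≤ ∫ u in s, ‖f u‖ * ‖g u‖ := by
        simpa only [Real.norm_eq_abs, abs_mul] using
          norm_integral_le_integral_norm (μ := volume.restrict s) (fun u => f u * g u)
    _ ≤ _ := by simpa using h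

/-- The unitary dilations of `L²(ℝ)` converge weakly to zero. -/
lemma tendsto_integral_mul_dilation {f g : ℝ → ℝ} (hf : MemLp f 2) (hg : MemLp g 2) :
    Tendsto (fun c : ℝ => ∫ u, f u * (c ^ (-(1 / 2) : ℝ) * g (u / c))) atTop (𝓝 0) := by
  have hf2 : Integrable (fun u => f u ^ 2) := hf.integrable_sq
  have hg2 : Integrable (fun u => g u ^ 2) := hg.integrable_sq
  have hA : Tendsto (fun c : ℝ => ∫ u in {u | √c < |u|}, f u ^ 2) atTop (𝓝 0) := by
    have hm : ∀ c : ℝ, MeasurableSet {u : ℝ | √c < |u|} := fun c =>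
      measurableSet_lt measurable_const measurable_norm
    simp only [← integral_indicator (hm _)]
    rw [← integral_zero ℝ ℝ]
    refine tendsto_integral_filter_of_dominated_convergence (fun u => f u ^ 2) ?_ ?_ hf2 ?_
    · exact Eventually.of_forall fun c => hf2.aestronglyMeasurable.indicator (hm c)
    · refine Eventually.of_forall fun c => Eventually.of_forall fun u => ?_
      refine (norm_indicator_le_norm_self _ _).trans ?_
      simp
    · refine Eventually.of_forall fun u => tendsto_const_nhds.congr' ?_
      filter_upwards [Real.tendsto_sqrt_atTop.eventually_ge_atTop |u|] with c hc
      rw [Set.indicator_of_notMem]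
      simpa using hc
  have hB : Tendsto (fun c : ℝ => ∫ u in {u | |u| ≤ (√c)⁻¹}, g u ^ 2) atTop (𝓝 0) := by
    have hm : ∀ c : ℝ, MeasurableSet {u : ℝ | |u| ≤ (√c)⁻¹} := fun c =>
      measurableSet_le measurable_norm measurable_const
    simp only [← integral_indicator (hm _)]
    rw [← integral_zero ℝ ℝ]
    refine tendsto_integral_filter_of_dominated_convergence (fun u => g u ^ 2) ?_ ?_ hg2 ?_
    · exact Eventually.of_forall fun c => hg2.aestronglyMeasurable.indicator (hm c)
    · refine Eventually.of_forall fun c => Eventually.of_forall fun u => ?_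
      refine (norm_indicator_le_norm_self _ _).trans ?_
      simp
    · filter_upwards [Measure.ae_ne volume (0 : ℝ)] with u hu
      refine tendsto_const_nhds.congr' ?_
      filter_upwards [(tendsto_inv_atTop_zero.comp Real.tendsto_sqrt_atTop).eventually_lt_const
        (abs_pos.2 hu)] with c hc
      rw [Set.indicator_of_notMem]
      simpa using hc
  have hlim : Tendsto (fun c : ℝ =>
      √(∫ u, f u ^ 2) * √(∫ u in {u | |u| ≤ (√c)⁻¹}, g u ^ 2) +
      √(∫ u in {u | √c < |u|}, f u ^ 2) * √(∫ u, g u ^ 2)) atTop (𝓝 0) := by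
    simpa using ((hB.sqrt.const_mul (√(∫ u, f u ^ 2))).add
      (hA.sqrt.mul_const (√(∫ u, g u ^ 2))))
  refine squeeze_zero_norm' ?_ hlim
  filter_upwards [eventually_gt_atTop 0] with c hc
  have hsc : 0 < √c := Real.sqrt_pos.2 hc
  set D : ℝ → ℝ := fun u => c ^ (-(1 / 2) : ℝ) * g (u / c) with hD
  have hcc : (c ^ (-(1 / 2) : ℝ)) ^ 2 = c⁻¹ := by
    rw [← Real.rpow_mul_natCast hc.le, ← Real.rpow_neg_one]
    norm_num
  have hDsq : ∀ u, D u ^ 2 = c⁻¹ * g (u / c) ^ 2 := fun u => by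
    rw [hD, mul_pow, hcc]
  have hgm : AEStronglyMeasurable (fun u => g (u / c)) := by
    refine hg.aestronglyMeasurable.comp_quasiMeasurePreserving ?_
    simp only [div_eq_inv_mul]
    exact Measure.quasiMeasurePreserving_smul volume (inv_ne_zero hc.ne')
  have hDL : MemLp D 2 := by
    refine (memLp_two_iff_integrable_sq (hgm.const_mul _)).2 ?_
    change Integrable (fun u => D u ^ 2)
    simp only [hDsq]
    exact (hg2.comp_div hc.ne').const_mul _
  have hDint : ∀ h : ℝ → ℝ, (∫ u, c⁻¹ * h (u / c)) = ∫ u, h u := fun h => by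
    rw [integral_const_mul, Measure.integral_comp_div, abs_of_pos hc, smul_eq_mul,
      inv_mul_cancel_left₀ hc.ne']
  have hm : MeasurableSet {u : ℝ | √c < |u|} :=
    measurableSet_lt measurable_const measurable_norm
  have hm' : MeasurableSet {u : ℝ | |u| ≤ (√c)⁻¹} :=
    measurableSet_le measurable_norm measurable_const
  have hDs : ∫ u in {u : ℝ | √c < |u|}ᶜ, D u ^ 2 = ∫ u in {u | |u| ≤ (√c)⁻¹}, g u ^ 2 := by
    rw [← integral_indicator hm.compl, ← integral_indicator hm',
      ← hDint ({u | |u| ≤ (√c)⁻¹}.indicator fun u => g u ^ 2)]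
    congr 1
    ext u
    simp only [Set.indicator_apply, hDsq, Set.mem_compl_iff, Set.mem_ofPred_eq, not_lt]
    have : |u / c| ≤ (√c)⁻¹ ↔ |u| ≤ √c := by
      rw [abs_div, abs_of_pos hc, div_le_iff₀ hc]
      congr! 1
      rw [inv_mul_eq_div, Real.div_sqrt]
    simp [this]
  have hfi : Integrable (fun u => f u * D u) := hf.integrable_mul hDL
  rw [← integral_add_compl hm hfi, add_comm]
  refine (norm_add_le _ _).trans (add_le_add ?_ ?_)
  · refine (abs_setIntegral_mul_le hf hDL _).trans ?_
    rw [hDs]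
    gcongr
    · exact Eventually.of_forall fun u => sq_nonneg _
    · exact Measure.restrict_le_self
  · refine (abs_setIntegral_mul_le hf hDL _).trans ?_
    have : ∫ u in {u : ℝ | √c < |u|}, D u ^ 2 ≤ ∫ u, g u ^ 2 := by
      rw [← hDint (fun u => g u ^ 2)]
      simp only [← hDsq]
      exact setIntegral_le_integral hDL.integrable_sq
        (Eventually.of_forall fun u => sq_nonneg _)
    gcongr

lemma tendsto_gfbmCov_mul_of_memLp {α γ s t : ℝ} (hs : MemLp (gfbmKernel α γ s) 2)
    (ht : MemLp (gfbmKernel α γ t) 2) :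
    Tendsto (fun c : ℝ => c ^ (-(α - γ / 2 + 1 / 2)) * gfbmCov α γ s (c * t)) atTop (𝓝 0) := by
  refine (tendsto_integral_mul_dilation hs ht).congr' ?_
  filter_upwards [eventually_gt_atTop 0] with c hc
  rw [gfbmCov_eq_integral_kernel, ← integral_const_mul]
  congr 1
  ext u
  rw [gfbmKernel_mul_left α γ t u hc]
  rw [show (-(1 / 2) : ℝ) = -(α - γ / 2 + 1 / 2) + (α - γ / 2) by ring, Real.rpow_add hc]
  ring

section ContinuousMap

variable {T : Type*} [TopologicalSpace T]

lemma ContinuousMap.mapsTo_iff_exists_forall_dense {K : Set T} (hK : IsCompact K) {U : Set ℝ}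
    (hU : IsOpen U) {D : Set K} (hD : Dense D) (f : C(T, ℝ)) :
    MapsTo f K U ↔ ∃ n : ℕ, ∀ d ∈ D, ∀ z ∉ U, 1 / ((n : ℝ) + 1) ≤ dist (f d) z := by
  constructor
  · intro h
    obtain ⟨δ, hδ, hsub⟩ := (hK.image f.continuous).exists_thickening_subset_open hU
      (Set.image_subset_iff.2 h)
    obtain ⟨n, hn⟩ := exists_nat_one_div_lt hδ
    refine ⟨n, fun d _ z hz => hn.le.trans ?_⟩
    by_contra! hlt
    exact hz (hsub (Metric.mem_thickening_iff.2
      ⟨f d, Set.mem_image_of_mem _ d.2, by rwa [dist_comm]⟩))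
  · rintro ⟨n, hn⟩ x hx
    have hcl : IsClosed {x : K | ∀ z ∉ U, 1 / ((n : ℝ) + 1) ≤ dist (f x) z} := by
      simp only [Set.ofPred_forall]
      refine isClosed_iInter fun z => isClosed_iInter fun _ => isClosed_le continuous_const ?_
      fun_prop
    have hall : ∀ x : K, ∀ z ∉ U, 1 / ((n : ℝ) + 1) ≤ dist (f x) z := fun x =>
      hcl.closure_subset_iff.2 hn (hD x)
    by_contra hxU
    have := hall ⟨x, hx⟩ (f x) hxU
    rw [dist_self] at this
    exact absurd this (not_le.2 (by positivity))

variable [SecondCountableTopology T] [LocallyCompactSpace T]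

lemma ContinuousMap.borel_eq_iSup_comap_eval :
    borel C(T, ℝ) = ⨆ t : T, MeasurableSpace.comap (fun f : C(T, ℝ) => f t) inferInstance := by
  apply le_antisymm
  · rw [borel_eq_generateFrom_of_subbasis ContinuousMap.compactOpen_eq]
    refine MeasurableSpace.generateFrom_le ?_
    rintro _ ⟨K, hK, U, hU, rfl⟩
    obtain ⟨D, hDc, hD⟩ := TopologicalSpace.exists_countable_dense K
    have heq : {f : C(T, ℝ) | MapsTo f K U} = ⋃ n : ℕ, ⋂ d ∈ D,
        (fun f : C(T, ℝ) => f d) ⁻¹' {y | ∀ z ∉ U, 1 / ((n : ℝ) + 1) ≤ dist y z} := by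
      ext f
      simpa using ContinuousMap.mapsTo_iff_exists_forall_dense hK hU hD f
    beta_reduce
    rw [heq]
    refine MeasurableSet.iUnion fun n => MeasurableSet.biInter hDc fun d _ => ?_
    refine MeasurableSpace.le_def.1 (le_iSup _ (d : T)) _ ⟨_, IsClosed.measurableSet ?_, rfl⟩
    simp only [Set.ofPred_forall]
    refine isClosed_iInter fun z => isClosed_iInter fun _ => isClosed_le continuous_const ?_
    fun_prop
  · refine iSup_le fun t => ?_
    borelize C(T, ℝ)
    exact (continuous_eval_const t).measurable.comap_le

noncomputable instance : MeasurableSpace C(T, ℝ) := borel _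

instance : BorelSpace C(T, ℝ) := ⟨rfl⟩

lemma ContinuousMap.measurable_of_eval {Ω : Type*} [MeasurableSpace Ω] {f : Ω → C(T, ℝ)}
    (hf : ∀ t, Measurable fun ω => f ω t) : Measurable f := by
  rw [measurable_iff_comap_le, BorelSpace.measurable_eq (α := C(T, ℝ)),
    ContinuousMap.borel_eq_iSup_comap_eval, MeasurableSpace.comap_iSup]
  refine iSup_le fun t => ?_
  rw [MeasurableSpace.comap_comp]
  exact (hf t).comap_le

lemma ContinuousMap.aemeasurable_of_eval {Ω : Type*} [MeasurableSpace Ω] {P : Measure Ω}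
    {f : Ω → C(T, ℝ)} (hf : ∀ t, AEMeasurable (fun ω => f ω t) P) : AEMeasurable f P :=
  NullMeasurable.aemeasurable fun _ hs =>
    ContinuousMap.measurable_of_eval (Ω := NullMeasurableSpace Ω P)
      (fun t _ h => (hf t).nullMeasurable h) hs

/-- A finite measure on `C(T, ℝ)` is determined by the characteristic functions of its
finite-dimensional marginals. -/
lemma ContinuousMap.measure_ext_of_charFun {μ ν : Measure C(T, ℝ)} [IsFiniteMeasure μ]
    [IsFiniteMeasure ν]
    (h : ∀ (I : Finset T) (a : I → ℝ),
      ∫ x, Complex.exp ((∑ i, a i * x i : ℝ) * Complex.I) ∂μ =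
        ∫ x, Complex.exp ((∑ i, a i * x i : ℝ) * Complex.I) ∂ν) : μ = ν := by
  have he : Measurable (fun x : C(T, ℝ) => (x : T → ℝ)) :=
    measurable_pi_lambda _ fun t => (continuous_eval_const t).measurable
  have hmap : μ.map (fun x : C(T, ℝ) => (x : T → ℝ)) = ν.map (fun x : C(T, ℝ) => (x : T → ℝ)) := by
    refine IsProjectiveLimit.unique
      (P := fun I => (ν.map (fun x : C(T, ℝ) => (x : T → ℝ))).map I.restrict) (fun I => ?_)
      (fun I => rfl)
    beta_reduce
    rw [Measure.map_map (Finset.measurable_restrict I) he,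
      Measure.map_map (Finset.measurable_restrict I) he]
    have hIe := (Finset.measurable_restrict (X := fun _ : T => ℝ) I).comp he
    classical
    refine Measure.ext_of_charFunDual (funext fun L => ?_)
    rw [charFunDual_apply, charFunDual_apply, integral_map hIe.aemeasurable (by fun_prop),
      integral_map hIe.aemeasurable (by fun_prop)]
    obtain ⟨a, hL⟩ : ∃ a : I → ℝ, ∀ v : I → ℝ, L v = ∑ i, a i * v i := by
      refine ⟨fun i => L (fun j => if i = j then 1 else 0), fun v => ?_⟩
      refine (L.toLinearMap.pi_apply_eq_sum_univ v).trans (Finset.sum_congr rfl fun i _ => ?_)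
      exact mul_comm _ _
    simp only [hL]
    exact h I a
  ext s hs
  rw [BorelSpace.measurable_eq (α := C(T, ℝ)), ContinuousMap.borel_eq_iSup_comap_eval] at hs
  have hcomap : (⨆ t : T, MeasurableSpace.comap (fun f : C(T, ℝ) => f t) inferInstance) =
      MeasurableSpace.comap (fun x : C(T, ℝ) => (x : T → ℝ)) MeasurableSpace.pi := by
    simp only [MeasurableSpace.pi, MeasurableSpace.comap_iSup, MeasurableSpace.comap_comp]
    rfl
  rw [hcomap] at hs
  obtain ⟨B, hB, rfl⟩ := hs
  rw [← Measure.map_apply he hB, ← Measure.map_apply he hB, hmap]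

end ContinuousMap

section PathFunctionals

lemma fracInt_eq_integral_unit {Ω : Type*} {θ : ℝ} (hθ : 0 < θ) (X : ℝ → Ω → ℝ) {s : ℝ}
    (hs : 0 ≤ s) (ω : Ω) :
    fracInt θ X s ω =
      (Real.Gamma θ)⁻¹ * (s ^ θ * ∫ w in (0 : ℝ)..1, (1 - w) ^ (θ - 1) * X (s * w) ω) := by
  unfold fracInt
  congr 1
  rcases hs.eq_or_lt with rfl | hs
  · simp [Real.zero_rpow hθ.ne']
  · have h := intervalIntegral.mul_integral_comp_mul_left (a := 0) (b := 1) (c := s)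
      (f := fun u => (s - u) ^ (θ - 1) * X u ω)
    rw [mul_zero, mul_one] at h
    rw [← h, show s ^ θ = s * s ^ (θ - 1) by rw [Real.rpow_sub_one hs.ne']; field_simp,
      mul_assoc, ← intervalIntegral.integral_const_mul (s ^ (θ - 1))]
    congr 1
    refine intervalIntegral.integral_congr fun w hw => ?_
    rw [Set.uIcc_of_le zero_le_one] at hw
    rw [show s - s * w = s * (1 - w) by ring, Real.mul_rpow hs.le (sub_nonneg.2 hw.2)]
    ring

lemma fracInt_mul {Ω : Type*} {θ : ℝ} (hθ : 0 < θ) (X : ℝ → Ω → ℝ) {c s : ℝ} (hc : 0 ≤ c)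
    (hs : 0 ≤ s) (ω : Ω) :
    fracInt θ X (c * s) ω = c ^ θ * fracInt θ (fun u => X (c * u)) s ω := by
  rw [fracInt_eq_integral_unit hθ X (mul_nonneg hc hs), fracInt_eq_integral_unit hθ _ hs,
    Real.mul_rpow hc hs]
  simp only [mul_assoc]
  ring

lemma runSup_eq_iSup_unit {Ω : Type*} (Y : ℝ → Ω → ℝ) {t : ℝ} (ht : 0 ≤ t) (ω : Ω) :
    runSup Y t ω = ⨆ v : Set.Icc (0 : ℝ) 1, |Y (t * v) ω| := by
  refine (Function.Surjective.iSup_congr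
    (fun v : Set.Icc (0 : ℝ) 1 => (⟨t * v, mul_nonneg ht v.2.1,
      mul_le_of_le_one_right ht v.2.2⟩ : Set.Icc (0 : ℝ) t)) ?_ fun v => rfl).symm
  rintro ⟨s, hs0, hst⟩
  rcases ht.eq_or_lt with rfl | ht
  · exact ⟨⟨0, by simp⟩, Subtype.ext (by simp; linarith)⟩
  · exact ⟨⟨s / t, div_nonneg hs0 ht.le, div_le_one_of_le₀ hst ht.le⟩,
      Subtype.ext (mul_div_cancel₀ _ ht.ne')⟩

lemma runSup_fracInt_mul {Ω : Type*} {θ : ℝ} (hθ : 0 < θ) (X : ℝ → Ω → ℝ) {c t : ℝ}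
    (hc : 0 ≤ c) (ht : 0 ≤ t) (ω : Ω) :
    runSup (fracInt θ X) (c * t) ω = c ^ θ * runSup (fracInt θ fun u => X (c * u)) t ω := by
  rw [runSup_eq_iSup_unit _ (mul_nonneg hc ht), runSup_eq_iSup_unit _ ht,
    Real.mul_iSup_of_nonneg (by positivity)]
  refine iSup_congr fun v => ?_
  rw [mul_assoc, fracInt_mul hθ X hc (mul_nonneg ht v.2.1), abs_mul,
    abs_of_nonneg (Real.rpow_nonneg hc θ)]

lemma runSup_fracInt_const_mul {Ω Ω' : Type*} (θ : ℝ) (X : ℝ → Ω → ℝ) (X' : ℝ → Ω' → ℝ)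
    {b : ℝ} (hb : 0 ≤ b) (t : ℝ) (ω : Ω) (ω' : Ω') (h : ∀ u, 0 ≤ u → X' u ω' = b * X u ω) :
    runSup (fracInt θ X') t ω' = b * runSup (fracInt θ X) t ω := by
  unfold runSup fracInt
  rw [Real.mul_iSup_of_nonneg hb]
  refine iSup_congr fun s => ?_
  rw [← abs_of_nonneg hb, ← abs_mul, mul_left_comm b,
    ← intervalIntegral.integral_const_mul b]
  congr 2
  refine intervalIntegral.integral_congr fun u hu => ?_
  rw [Set.uIcc_of_le s.2.1] at hu
  rw [h u hu.1]
  ring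

/-- The coordinate process on the space of continuous paths. -/
def pathEval (u : ℝ) (x : C(ℝ≥0, ℝ)) : ℝ := x u.toNNReal

lemma continuous_integral_mul_pathEval {θ : ℝ} (hθ : 0 < θ) :
    Continuous fun p : ℝ × C(ℝ≥0, ℝ) =>
      ∫ w in (0 : ℝ)..1, (1 - w) ^ (θ - 1) * pathEval (p.1 * w) p.2 := by
  have hker : IntervalIntegrable (fun w : ℝ => (1 - w) ^ (θ - 1)) volume 0 1 := by
    simpa using ((intervalIntegral.intervalIntegrable_rpow' (a := 0) (b := 1)
      (by linarith : -1 < θ - 1)).comp_sub_left 1).symm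
  rw [continuous_iff_continuousAt]
  rintro ⟨s₀, x₀⟩
  set K : Set ℝ≥0 := Set.Icc 0 (|s₀| + 1).toNNReal with hK
  have hKc : IsCompact K := isCompact_Icc
  obtain ⟨M, hM⟩ := hKc.exists_bound_of_continuousOn x₀.continuous.continuousOn
  have hnhds : ∀ᶠ p : ℝ × C(ℝ≥0, ℝ) in 𝓝 (s₀, x₀),
      |p.1| < |s₀| + 1 ∧ MapsTo p.2 K (Metric.ball 0 (M + 1)) := by
    refine ((continuous_abs.comp continuous_fst).continuousAt.eventually_lt
      (continuousAt_const (y := |s₀| + 1)) (by simp)).and ?_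
    refine continuous_snd.continuousAt.eventually
      ((ContinuousMap.isOpen_setOfPred_mapsTo hKc Metric.isOpen_ball).mem_nhds ?_)
    intro k hk
    have := hM k hk
    simp only [mem_ball_zero_iff]
    linarith
  refine intervalIntegral.continuousAt_of_dominated_interval
    (bound := fun w => (1 - w) ^ (θ - 1) * (M + 1)) ?_ ?_ (hker.mul_const _) ?_
  · refine Eventually.of_forall fun p => ?_
    have h1 : Measurable fun w : ℝ => (1 - w) ^ (θ - 1) := by fun_prop
    have h2 : Continuous fun w : ℝ => pathEval (p.1 * w) p.2 := by
      unfold pathEval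
      fun_prop
    exact (h1.mul h2.measurable).aestronglyMeasurable
  · filter_upwards [hnhds] with p hp
    refine Eventually.of_forall fun w hw => ?_
    rw [Set.uIoc_of_le zero_le_one] at hw
    have hk : (p.1 * w).toNNReal ∈ K := by
      refine ⟨zero_le, Real.toNNReal_le_toNNReal ?_⟩
      refine (le_abs_self _).trans ?_
      rw [abs_mul, abs_of_pos hw.1]
      exact (mul_le_of_le_one_right (abs_nonneg _) hw.2).trans hp.1.le
    have := hp.2 hk
    rw [mem_ball_zero_iff] at this
    have h0 : 0 ≤ (1 - w) ^ (θ - 1) := Real.rpow_nonneg (sub_nonneg.2 hw.2) _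
    rw [norm_mul, Real.norm_of_nonneg h0]
    exact mul_le_mul_of_nonneg_left this.le h0
  · refine Eventually.of_forall fun w _ => Continuous.continuousAt ?_
    unfold pathEval
    fun_prop

lemma continuous_runSup_fracInt_pathEval {θ : ℝ} (hθ : 0 < θ) {t : ℝ} (ht : 0 ≤ t) :
    Continuous fun x : C(ℝ≥0, ℝ) => runSup (fracInt θ pathEval) t x := by
  have hcont : Continuous fun p : C(ℝ≥0, ℝ) × ℝ =>
      |(Real.Gamma θ)⁻¹ * (|t * p.2| ^ θ *
        ∫ w in (0 : ℝ)..1, (1 - w) ^ (θ - 1) * pathEval (t * p.2 * w) p.1)| := by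
    have h1 : Continuous fun p : C(ℝ≥0, ℝ) × ℝ => |t * p.2| ^ θ :=
      (by fun_prop : Continuous fun p : C(ℝ≥0, ℝ) × ℝ => |t * p.2|).rpow_const
        fun _ => Or.inr hθ.le
    have h2 := (continuous_integral_mul_pathEval hθ).comp
      (by fun_prop : Continuous fun p : C(ℝ≥0, ℝ) × ℝ => (t * p.2, p.1))
    exact (continuous_const.mul (h1.mul h2)).abs
  have h := (isCompact_Icc (a := (0 : ℝ)) (b := 1)).continuous_sSup
    (f := fun (x : C(ℝ≥0, ℝ)) (v : ℝ) => |(Real.Gamma θ)⁻¹ * (|t * v| ^ θ *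
        ∫ w in (0 : ℝ)..1, (1 - w) ^ (θ - 1) * pathEval (t * v * w) x)|) hcont
  convert h using 2 with x
  rw [runSup_eq_iSup_unit _ ht, sSup_image']
  refine iSup_congr fun v => ?_
  rw [fracInt_eq_integral_unit hθ _ (mul_nonneg ht v.2.1),
    abs_of_nonneg (mul_nonneg ht v.2.1)]

/-- The lower limit in Chung's law at infinity as a functional of the path. -/
noncomputable def chungLiminf (θ β H : ℝ) (x : C(ℝ≥0, ℝ)) : ℝ≥0∞ :=
  liminf (fun t : ℝ => ENNReal.ofReal
    (runSup (fracInt θ pathEval) t x * (Real.log (Real.log t)) ^ β / t ^ (H + θ))) atTop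

lemma measurable_chungLiminf {θ : ℝ} (hθ : 0 < θ) (β H : ℝ) :
    Measurable (chungLiminf θ β H) := by
  unfold chungLiminf
  simp only [(atTop_hasCountableBasis_of_archimedean (R := ℝ)).1.liminf_eq_iSup_iInf]
  refine Measurable.iSup fun n => Measurable.iSup fun _ => ?_
  refine (upperSemicontinuous_biInf fun t ht => Continuous.upperSemicontinuous ?_).measurable
  have ht0 : 0 ≤ t := (Nat.cast_nonneg n).trans ht
  exact ENNReal.continuous_ofReal.comp
    (((continuous_runSup_fracInt_pathEval hθ ht0).mul_const _).div_const _)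

/-- The rescaling `x ↦ c ^ (-H) x(c ·)` of paths. -/
noncomputable def pathScale (H : ℝ) (c : ℝ≥0) (x : C(ℝ≥0, ℝ)) : C(ℝ≥0, ℝ) :=
  (c : ℝ) ^ (-H) • x.comp ⟨fun t => c * t, by fun_prop⟩

@[simp]
lemma pathScale_apply (H : ℝ) (c : ℝ≥0) (x : C(ℝ≥0, ℝ)) (t : ℝ≥0) :
    pathScale H c x t = (c : ℝ) ^ (-H) * x (c * t) := rfl

lemma measurable_pathScale (H : ℝ) (c : ℝ≥0) : Measurable (pathScale H c) :=
  ContinuousMap.measurable_of_eval fun t =>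
    (continuous_eval_const (c * t)).measurable.const_mul ((c : ℝ) ^ (-H))

lemma runSup_pathScale {θ : ℝ} (hθ : 0 < θ) (H : ℝ) {c : ℝ≥0} (hc : 0 < c) {t : ℝ}
    (ht : 0 ≤ t) (x : C(ℝ≥0, ℝ)) :
    runSup (fracInt θ pathEval) t (pathScale H c x) =
      (c : ℝ) ^ (-(H + θ)) * runSup (fracInt θ pathEval) (c * t) x := by
  have hc' : (0 : ℝ) < c := hc
  rw [runSup_fracInt_mul hθ pathEval hc'.le ht, ← mul_assoc, ← Real.rpow_add hc']
  rw [show -(H + θ) + θ = -H by ring]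
  refine runSup_fracInt_const_mul θ _ _ (by positivity) t x _ fun u hu => ?_
  simp only [pathEval, pathScale_apply]
  rw [Real.toNNReal_mul hc'.le, Real.toNNReal_coe]

lemma tendsto_log_log_mul_div {c : ℝ} (hc : 0 < c) :
    Tendsto (fun t => Real.log (Real.log (c * t)) / Real.log (Real.log t)) atTop (𝓝 1) := by
  have hL : Tendsto Real.log atTop atTop := Real.tendsto_log_atTop
  have hLL : Tendsto (fun t => Real.log (Real.log t)) atTop atTop := hL.comp hL
  have h1 : Tendsto (fun t => 1 + Real.log c / Real.log t) atTop (𝓝 1) := by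
    simpa using (hL.const_div_atTop (Real.log c)).const_add 1
  have h2 : Tendsto (fun t => Real.log (1 + Real.log c / Real.log t)) atTop (𝓝 0) := by
    simpa using h1.log one_ne_zero
  have h3 : Tendsto (fun t => 1 + Real.log (1 + Real.log c / Real.log t) /
      Real.log (Real.log t)) atTop (𝓝 1) := by
    simpa using (h2.div_atTop hLL).const_add 1
  refine h3.congr' ?_
  filter_upwards [eventually_gt_atTop 0, hL.eventually_gt_atTop 0, hLL.eventually_gt_atTop 0,
    h1.eventually_const_lt one_pos] with t ht hlt hllt h1t
  rw [Real.log_mul hc.ne' ht.ne', show Real.log c + Real.log t =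
    Real.log t * (1 + Real.log c / Real.log t) by field_simp; ring,
    Real.log_mul hlt.ne' h1t.ne', add_div, div_self hllt.ne']

lemma ENNReal.liminf_le_liminf_mul_of_tendsto_one {ι : Type*} {l : Filter ι} [l.NeBot]
    (u : ι → ℝ≥0∞) {v : ι → ℝ≥0∞} (hv : Tendsto v l (𝓝 1)) :
    liminf u l ≤ liminf (u * v) l := by
  simpa [hv.liminf_eq] using ENNReal.le_liminf_mul (u := u) (v := v) (f := l)

lemma chungLiminf_pathScale {θ : ℝ} (hθ : 0 < θ) (β H : ℝ) {c : ℝ≥0} (hc : 0 < c)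
    (x : C(ℝ≥0, ℝ)) : chungLiminf θ β H (pathScale H c x) = chungLiminf θ β H x := by
  have hc' : (0 : ℝ) < c := hc
  set g : ℝ → ℝ≥0∞ := fun t => ENNReal.ofReal
    (runSup (fracInt θ pathEval) t x * (Real.log (Real.log t)) ^ β / t ^ (H + θ)) with hg
  set k : ℝ → ℝ≥0∞ := fun t => ENNReal.ofReal
    (runSup (fracInt θ pathEval) t (pathScale H c x) * (Real.log (Real.log t)) ^ β /
      t ^ (H + θ)) with hk
  have hgc : liminf g atTop = liminf (fun t => g (c * t)) atTop := by
    calc liminf g atTop = liminf g (map (OrderIso.mulLeft₀ (c : ℝ) hc') atTop) := by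
          rw [OrderIso.map_atTop]
      _ = liminf (fun t => g (c * t)) atTop := rfl
  have hLL : Tendsto (fun t => Real.log (Real.log t)) atTop atTop :=
    Real.tendsto_log_atTop.comp Real.tendsto_log_atTop
  have hLLc : Tendsto (fun t => Real.log (Real.log (c * t))) atTop atTop :=
    hLL.comp (tendsto_id.const_mul_atTop hc')
  have hratio := tendsto_log_log_mul_div hc'
  have hv : ∀ b : ℝ, Tendsto (fun t => ENNReal.ofReal
      ((Real.log (Real.log (c * t)) / Real.log (Real.log t)) ^ b)) atTop (𝓝 1) := fun b => by
    have := hratio.rpow_const (p := b) (Or.inl one_ne_zero)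
    rw [Real.one_rpow] at this
    simpa using ENNReal.tendsto_ofReal this
  have hrel : ∀ᶠ t in atTop, g (c * t) = k t * ENNReal.ofReal
      ((Real.log (Real.log (c * t)) / Real.log (Real.log t)) ^ β) := by
    filter_upwards [eventually_gt_atTop 0, hLL.eventually_gt_atTop 0,
      hLLc.eventually_gt_atTop 0] with t ht h1 h2
    rw [hg, hk]
    beta_reduce
    rw [← ENNReal.ofReal_mul' (by positivity), runSup_pathScale hθ H hc ht.le,
      Real.div_rpow h2.le h1.le, Real.mul_rpow hc'.le ht.le, Real.rpow_neg hc'.le]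
    congr 1
    have := (Real.rpow_pos_of_pos h1 β).ne'
    field_simp
  have hrel' : ∀ᶠ t in atTop, k t = g (c * t) * ENNReal.ofReal
      ((Real.log (Real.log (c * t)) / Real.log (Real.log t)) ^ (-β)) := by
    filter_upwards [hrel, hLL.eventually_gt_atTop 0, hLLc.eventually_gt_atTop 0]
      with t ht h1 h2
    rw [ht, mul_assoc, ← ENNReal.ofReal_mul (by positivity), ← Real.rpow_add (by positivity),
      add_neg_cancel, Real.rpow_zero, ENNReal.ofReal_one, mul_one]
  change liminf k atTop = liminf g atTop
  rw [hgc]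
  apply le_antisymm
  · rw [liminf_congr hrel]
    exact ENNReal.liminf_le_liminf_mul_of_tendsto_one _ (hv β)
  · rw [liminf_congr hrel']
    exact ENNReal.liminf_le_liminf_mul_of_tendsto_one (fun t : ℝ => g (c * t)) (hv (-β))

end PathFunctionals

section Mixing

open scoped ComplexConjugate

lemma sq_norm_setIntegral_le {E : Type*} [MeasurableSpace E] {μ : Measure E}
    [IsProbabilityMeasure μ] {h : E → ℂ} (hh : MemLp h 2 μ) (A : Set E) :
    ‖∫ x in A, h x ∂μ‖ ^ 2 ≤ ∫ x, ‖h x‖ ^ 2 ∂μ := by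
  have h1 : ‖∫ x in A, h x ∂μ‖ ≤ ∫ x, ‖h x‖ ∂μ :=
    (norm_integral_le_integral_norm _).trans <| setIntegral_le_integral
      (hh.integrable one_le_two).norm (Eventually.of_forall fun x => norm_nonneg _)
  have h2 : (∫ x, ‖h x‖ ∂μ) ^ 2 ≤ ∫ x, ‖h x‖ ^ 2 ∂μ := by
    have := variance_nonneg (fun x => ‖h x‖) μ
    rw [variance_eq_sub hh.norm] at this
    simpa using this
  exact (pow_le_pow_left₀ (norm_nonneg _) h1 2).trans h2

/-- If bounded functions are pairwise nearly orthogonal and have the same integral over `A`, then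
this integral is small. -/
lemma sq_norm_le_of_nearly_orthogonal {E : Type*} [MeasurableSpace E] {μ : Measure E}
    [IsProbabilityMeasure μ] {g : ℕ → E → ℂ} (hg : ∀ k, Measurable (g k))
    (hb : ∀ k x, ‖g k x‖ ≤ 2) {ε : ℝ} (hε : 0 ≤ ε)
    (ho : ∀ k l, k < l → ‖∫ x, g k x * conj (g l x) ∂μ‖ ≤ ε) {A : Set E} {a : ℂ}
    (ha : ∀ k, ∫ x in A, g k x ∂μ = a) : ‖a‖ ^ 2 ≤ ε := by
  have hL : ∀ k, MemLp (g k) 2 μ := fun k =>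
    MemLp.of_bound (hg k).aestronglyMeasurable 2 (Eventually.of_forall (hb k))
  have hprod : ∀ k l, Integrable (fun x => g k x * conj (g l x)) μ := fun k l => by
    refine Integrable.of_bound (C := 4) (by fun_prop) (Eventually.of_forall fun x => ?_)
    rw [norm_mul, RCLike.norm_conj]
    nlinarith [hb k x, hb l x, norm_nonneg (g k x), norm_nonneg (g l x)]
  have ho' : ∀ k l, k ≠ l → ‖∫ x, g k x * conj (g l x) ∂μ‖ ≤ ε := by
    intro k l hkl
    rcases hkl.lt_or_gt with h | h
    · exact ho k l h
    · have := ho l k h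
      rw [← RCLike.norm_conj, ← integral_conj] at this
      simpa [mul_comm] using this
  have hd : ∀ k, ‖∫ x, g k x * conj (g k x) ∂μ‖ ≤ 4 := fun k => by
    refine (norm_integral_le_of_norm_le_const (C := 4) (Eventually.of_forall fun x => ?_)).trans
      (by simp)
    rw [norm_mul, RCLike.norm_conj]
    nlinarith [hb k x, norm_nonneg (g k x)]
  have key : ∀ N : ℕ, (N : ℝ) ^ 2 * ‖a‖ ^ 2 ≤ N * 4 + (N : ℝ) ^ 2 * ε := by
    intro N
    have h1 : ∫ x in A, ∑ k ∈ Finset.range N, g k x ∂μ = N * a := by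
      rw [integral_finsetSum _ fun k _ => ((hL k).integrable one_le_two).integrableOn]
      simp [ha]
    have h2 := sq_norm_setIntegral_le (memLp_finsetSum (Finset.range N) fun k _ => hL k) A
    rw [h1, norm_mul, mul_pow, Complex.norm_natCast] at h2
    refine h2.trans ?_
    have h3 : ((∫ x, ‖∑ k ∈ Finset.range N, g k x‖ ^ 2 ∂μ : ℝ) : ℂ) =
        ∑ k ∈ Finset.range N, ∑ l ∈ Finset.range N, ∫ x, g k x * conj (g l x) ∂μ := by
      rw [← integral_complex_ofReal]
      simp only [Complex.ofReal_pow, ← Complex.mul_conj', map_sum, Finset.sum_mul_sum]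
      rw [integral_finsetSum _ fun k _ => integrable_finsetSum _ fun l _ => hprod k l]
      exact Finset.sum_congr rfl fun k _ => integral_finsetSum _ fun l _ => hprod k l
    have h4 : ‖((∫ x, ‖∑ k ∈ Finset.range N, g k x‖ ^ 2 ∂μ : ℝ) : ℂ)‖ ≤
        ∑ k ∈ Finset.range N, ∑ l ∈ Finset.range N, ((if k = l then 4 else 0) + ε) := by
      rw [h3]
      refine norm_sum_le_of_le _ fun k _ => norm_sum_le_of_le _ fun l _ => ?_
      split_ifs with hkl
      · subst hkl
        linarith [hd k]
      · linarith [ho' k l hkl]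
    rw [Complex.norm_real] at h4
    refine (le_abs_self _).trans (h4.trans ?_)
    simp only [Finset.sum_add_distrib, Finset.sum_ite_eq, Finset.sum_const, Finset.card_range,
      nsmul_eq_mul]
    rw [Finset.sum_congr rfl fun k hk => if_pos hk]
    simp only [Finset.sum_const, Finset.card_range, nsmul_eq_mul]
    exact le_of_eq (by ring)
  have hlim : Tendsto (fun N : ℕ => 4 / (N : ℝ) + ε) atTop (𝓝 (0 + ε)) :=
    (tendsto_const_div_atTop_nhds_zero_nat 4).add_const ε
  rw [zero_add] at hlim
  refine ge_of_tendsto hlim ?_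
  filter_upwards [eventually_gt_atTop 0] with N hN
  have hN' : (0 : ℝ) < N := Nat.cast_pos.2 hN
  have := key N
  rw [div_add' _ _ _ hN'.ne', le_div_iff₀ hN']
  nlinarith

/-- The variance of `∑ i, a i * X (t i)` for a process with covariance `K`. -/
def combVariance {ι : Type} [Fintype ι] (K : ℝ≥0 → ℝ≥0 → ℝ) (t : ι → ℝ≥0) (a : ι → ℝ) : ℝ :=
  ∑ i, ∑ j, a i * a j * K (t i) (t j)

/-- `μ` is the law of a continuous centered Gaussian process with covariance `K`. -/
def IsGaussianPathLaw (K : ℝ≥0 → ℝ≥0 → ℝ) (μ : Measure C(ℝ≥0, ℝ)) : Prop :=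
  ∀ (ι : Type) [Fintype ι] (t : ι → ℝ≥0) (a : ι → ℝ),
    ∫ x, Complex.exp ((∑ i, a i * x (t i) : ℝ) * Complex.I) ∂μ =
      (Real.exp (-combVariance K t a / 2) : ℝ)

/-- `K` is the covariance of an `H`-self-similar process. -/
def IsSelfSimilarCov (H : ℝ) (K : ℝ≥0 → ℝ≥0 → ℝ) : Prop :=
  ∀ c s t : ℝ≥0, 0 < c → K (c * s) (c * t) = (c : ℝ) ^ (2 * H) * K s t

variable {K : ℝ≥0 → ℝ≥0 → ℝ} {μ : Measure C(ℝ≥0, ℝ)} {H : ℝ}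

lemma measurable_path_sum {ι : Type} [Fintype ι] (t : ι → ℝ≥0) (a : ι → ℝ) :
    Measurable fun x : C(ℝ≥0, ℝ) => ∑ i, a i * x (t i) :=
  Finset.measurable_sum _ fun i _ => (continuous_eval_const (t i)).measurable.const_mul _

lemma measurable_char_path_sum {ι : Type} [Fintype ι] (t : ι → ℝ≥0) (a : ι → ℝ) :
    Measurable fun x : C(ℝ≥0, ℝ) => Complex.exp ((∑ i, a i * x (t i) : ℝ) * Complex.I) := by
  have := measurable_path_sum t a
  fun_prop

lemma sum_mul_pathScale {ι : Type} [Fintype ι] (t : ι → ℝ≥0) (a : ι → ℝ) (c : ℝ≥0)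
    (x : C(ℝ≥0, ℝ)) : ∑ i, a i * pathScale H c x (t i) =
      ∑ i, ((c : ℝ) ^ (-H) * a i) * x (c * t i) :=
  Finset.sum_congr rfl fun i _ => by
    rw [pathScale_apply]
    ring

lemma IsSelfSimilarCov.combVariance_scale (hK : IsSelfSimilarCov H K) {ι : Type} [Fintype ι]
    (t : ι → ℝ≥0) (a : ι → ℝ) {c : ℝ≥0} (hc : 0 < c) :
    combVariance K (fun i => c * t i) (fun i => (c : ℝ) ^ (-H) * a i) = combVariance K t a := by
  have hc' : (0 : ℝ) < c := hc
  unfold combVariance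
  refine Finset.sum_congr rfl fun i _ => Finset.sum_congr rfl fun j _ => ?_
  rw [hK c _ _ hc]
  have : (c : ℝ) ^ (-H) * (c : ℝ) ^ (-H) * (c : ℝ) ^ (2 * H) = 1 := by
    rw [← Real.rpow_add hc', ← Real.rpow_add hc']
    ring_nf
    exact Real.rpow_zero _
  linear_combination a i * a j * K (t i) (t j) * this

lemma IsGaussianPathLaw.map_pathScale [IsFiniteMeasure μ] (hμ : IsGaussianPathLaw K μ)
    (hK : IsSelfSimilarCov H K) {c : ℝ≥0} (hc : 0 < c) : μ.map (pathScale H c) = μ := by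
  refine ContinuousMap.measure_ext_of_charFun fun I a => ?_
  rw [integral_map (measurable_pathScale H c).aemeasurable
    (measurable_char_path_sum _ a).aestronglyMeasurable]
  simp only [sum_mul_pathScale]
  rw [hμ I (fun i => c * (i : ℝ≥0)), hμ I (fun i => (i : ℝ≥0)), hK.combVariance_scale _ _ hc]

lemma IsGaussianPathLaw.integral_char_mul_conj (hμ : IsGaussianPathLaw K μ)
    (hK : IsSelfSimilarCov H K) (hsymm : ∀ s t, K s t = K t s) {ι : Type} [Fintype ι]
    (t : ι → ℝ≥0) (a : ι → ℝ) {c d : ℝ≥0} (hc : 0 < c) (hd : 0 < d) :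
    ∫ x, Complex.exp ((∑ i, a i * pathScale H c x (t i) : ℝ) * Complex.I) *
      conj (Complex.exp ((∑ i, a i * pathScale H d x (t i) : ℝ) * Complex.I)) ∂μ =
      (Real.exp (-combVariance K t a + ∑ i, ∑ j, a i * a j *
        (((d / c : ℝ≥0) : ℝ) ^ (-H) * K (t i) (d / c * t j))) : ℝ) := by
  have hc' : (0 : ℝ) < c := hc
  have hd' : (0 : ℝ) < d := hd
  set t' : ι ⊕ ι → ℝ≥0 := Sum.elim (fun i => c * t i) (fun i => d * t i) with ht'
  set a' : ι ⊕ ι → ℝ := Sum.elim (fun i => (c : ℝ) ^ (-H) * a i)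
    (fun i => -((d : ℝ) ^ (-H) * a i)) with ha'
  have h1 : ∀ x : C(ℝ≥0, ℝ),
      Complex.exp ((∑ i, a i * pathScale H c x (t i) : ℝ) * Complex.I) *
        conj (Complex.exp ((∑ i, a i * pathScale H d x (t i) : ℝ) * Complex.I)) =
      Complex.exp ((∑ i, a' i * x (t' i) : ℝ) * Complex.I) := by
    intro x
    rw [← Complex.exp_conj, ← Complex.exp_add, map_mul, Complex.conj_I, Complex.conj_ofReal,
      sum_mul_pathScale, sum_mul_pathScale, Fintype.sum_sum_type]
    congr 1
    simp only [ht', ha', Sum.elim_inl, Sum.elim_inr, neg_mul, Finset.sum_neg_distrib]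
    push_cast
    ring
  simp only [h1]
  rw [hμ (ι ⊕ ι) t' a']
  congr 2
  have hcross : ∀ i j, ((c : ℝ) ^ (-H) * a i) * ((d : ℝ) ^ (-H) * a j) *
      K (c * t i) (d * t j) = a i * a j *
        (((d / c : ℝ≥0) : ℝ) ^ (-H) * K (t i) (d / c * t j)) := by
    intro i j
    have hdc : d * t j = c * (d / c * t j) := by
      rw [← mul_assoc, mul_div_cancel₀ _ hc.ne']
    rw [hdc, hK c _ _ hc, NNReal.coe_div, Real.div_rpow hd'.le hc'.le]
    have h2 : (c : ℝ) ^ (-H) * (c : ℝ) ^ (2 * H) = ((c : ℝ) ^ (-H))⁻¹ := by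
      rw [← Real.rpow_add hc', ← Real.rpow_neg hc'.le]
      ring_nf
    rw [div_eq_mul_inv _ ((c : ℝ) ^ (-H)), ← h2]
    ring
  have hcross' : ∑ i, ∑ j, ((d : ℝ) ^ (-H) * a i) * ((c : ℝ) ^ (-H) * a j) *
      K (d * t i) (c * t j) = ∑ i, ∑ j, a i * a j *
        (((d / c : ℝ≥0) : ℝ) ^ (-H) * K (t i) (d / c * t j)) := by
    rw [Finset.sum_comm]
    refine Finset.sum_congr rfl fun i _ => Finset.sum_congr rfl fun j _ => ?_
    rw [← hcross, hsymm]
    ring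
  have hvar : combVariance K t' a' = 2 * combVariance K t a - 2 * ∑ i, ∑ j, a i * a j *
      (((d / c : ℝ≥0) : ℝ) ^ (-H) * K (t i) (d / c * t j)) := by
    have hvc := hK.combVariance_scale t a hc
    have hvd := hK.combVariance_scale t a hd
    unfold combVariance at hvc hvd ⊢
    simp only [Fintype.sum_sum_type, ht', ha', Sum.elim_inl, Sum.elim_inr, neg_mul, mul_neg,
      Finset.sum_add_distrib, Finset.sum_neg_distrib]
    rw [hvc, hvd, hcross']
    simp only [hcross]
    ring
  rw [hvar]
  ring

/-- Events invariant under rescaling are independent of the finite-dimensional marginals. -/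
lemma IsGaussianPathLaw.setIntegral_char_eq [IsProbabilityMeasure μ]
    (hμ : IsGaussianPathLaw K μ) (hK : IsSelfSimilarCov H K) (hsymm : ∀ s t, K s t = K t s)
    (hdecay : ∀ s t, Tendsto (fun c : ℝ≥0 => (c : ℝ) ^ (-H) * K s (c * t)) atTop (𝓝 0))
    {A : Set C(ℝ≥0, ℝ)} (hA : MeasurableSet A)
    (hinv : ∀ c : ℝ≥0, 0 < c → pathScale H c ⁻¹' A = A) {ι : Type} [Fintype ι]
    (t : ι → ℝ≥0) (a : ι → ℝ) :
    ∫ x in A, Complex.exp ((∑ i, a i * x (t i) : ℝ) * Complex.I) ∂μ =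
      μ.real A * ∫ x, Complex.exp ((∑ i, a i * x (t i) : ℝ) * Complex.I) ∂μ := by
  rw [hμ ι t a]
  set m : ℝ := Real.exp (-combVariance K t a / 2) with hm
  set F : C(ℝ≥0, ℝ) → ℂ := fun x => Complex.exp ((∑ i, a i * x (t i) : ℝ) * Complex.I) with hF
  have hFm : Measurable F := measurable_char_path_sum t a
  have hFb : ∀ x, ‖F x‖ = 1 := fun x => Complex.norm_exp_ofReal_mul_I _
  have hFi : ∀ c : ℝ≥0, Integrable (fun x => F (pathScale H c x)) μ := fun c =>
    Integrable.of_bound (hFm.comp (measurable_pathScale H c)).aestronglyMeasurable 1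
      (Eventually.of_forall fun x => (hFb _).le)
  have hF1 : ∀ c : ℝ≥0, 0 < c → ∫ x, F (pathScale H c x) ∂μ = m := fun c hc => by
    rw [← integral_map (measurable_pathScale H c).aemeasurable hFm.aestronglyMeasurable,
      hμ.map_pathScale hK hc, hF, hμ ι t a]
  have hm1 : |m| ≤ 1 := by
    have := norm_integral_le_of_norm_le_const (μ := μ) (C := 1)
      (Eventually.of_forall fun x => (hFb (pathScale H 1 x)).le)
    rw [hF1 1 one_pos] at this
    simpa using this
  have hgoal : ∫ x in A, (F x - m) ∂μ = 0 := by
    have hsmall : ∀ ε : ℝ, 0 < ε → ‖∫ x in A, (F x - m) ∂μ‖ ^ 2 ≤ ε := by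
      intro ε hε
      have hρ : Tendsto (fun e : ℝ≥0 => ∑ i, ∑ j, a i * a j *
          ((e : ℝ) ^ (-H) * K (t i) (e * t j))) atTop (𝓝 0) := by
        rw [← Finset.sum_const_zero (s := (Finset.univ : Finset ι))]
        refine tendsto_finsetSum _ fun i _ => ?_
        rw [← Finset.sum_const_zero (s := (Finset.univ : Finset ι))]
        refine tendsto_finsetSum _ fun j _ => ?_
        simpa using (hdecay (t i) (t j)).const_mul (a i * a j)
      have hexp : Tendsto (fun e : ℝ≥0 => |Real.exp (-combVariance K t a + ∑ i, ∑ j, a i * a j *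
          ((e : ℝ) ^ (-H) * K (t i) (e * t j))) - m * m|) atTop (𝓝 0) := by
        have hmm : m * m = Real.exp (-combVariance K t a + 0) := by
          rw [hm, ← Real.exp_add]
          congr 1
          ring
        have := ((Real.continuous_exp.tendsto _).comp
          (hρ.const_add (-combVariance K t a))).sub_const (m * m)
        rw [hmm, sub_self, ← hmm] at this
        simpa using this.abs
      obtain ⟨C, hC⟩ := eventually_atTop.1
        ((hexp.eventually_lt_const hε).and (eventually_ge_atTop 1))
      have hC1 : 1 ≤ C := (hC C le_rfl).2
      have hCpos : 0 < C := one_pos.trans_le hC1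
      refine sq_norm_le_of_nearly_orthogonal (A := A) (μ := μ)
        (g := fun k x => F (pathScale H (C ^ k) x) - m) (fun k => ?_) (fun k x => ?_) hε.le ?_
        fun k => ?_
      · exact (hFm.comp (measurable_pathScale H _)).sub_const _
      · refine (norm_sub_le _ _).trans ?_
        rw [hFb, Complex.norm_real, Real.norm_eq_abs]
        linarith
      · intro k l hkl
        have hk : 0 < C ^ k := pow_pos hCpos k
        have hl : 0 < C ^ l := pow_pos hCpos l
        have hpair := hμ.integral_char_mul_conj hK hsymm t a hk hl
        have hprodi : Integrable (fun x => F (pathScale H (C ^ k) x) *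
            conj (F (pathScale H (C ^ l) x))) μ := by
          have h1 := hFm.comp (measurable_pathScale H (C ^ k))
          have h2 := hFm.comp (measurable_pathScale H (C ^ l))
          refine Integrable.of_bound (C := 1)
            (h1.mul (Complex.continuous_conj.measurable.comp h2)).aestronglyMeasurable
            (Eventually.of_forall fun x => ?_)
          rw [norm_mul, RCLike.norm_conj, hFb, hFb, one_mul]
        have hconji : Integrable (fun x => conj (F (pathScale H (C ^ l) x))) μ :=
          Complex.conjCLE.toContinuousLinearMap.integrable_comp (hFi (C ^ l))
        have hexpand : ∫ x, (F (pathScale H (C ^ k) x) - m) *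
            conj (F (pathScale H (C ^ l) x) - m) ∂μ =
            ∫ x, F (pathScale H (C ^ k) x) * conj (F (pathScale H (C ^ l) x)) ∂μ - m * m := by
          have : ∀ x, (F (pathScale H (C ^ k) x) - m) * conj (F (pathScale H (C ^ l) x) - m) =
              F (pathScale H (C ^ k) x) * conj (F (pathScale H (C ^ l) x)) -
                m * F (pathScale H (C ^ k) x) - m * conj (F (pathScale H (C ^ l) x)) + m * m := by
            intro x
            rw [map_sub, Complex.conj_ofReal]
            ring
          simp only [this]
          have hi2 : Integrable (fun x => (m : ℂ) * F (pathScale H (C ^ k) x)) μ :=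
            (hFi _).const_mul _
          have hi12 : Integrable (fun x => F (pathScale H (C ^ k) x) *
              conj (F (pathScale H (C ^ l) x)) - m * F (pathScale H (C ^ k) x)) μ :=
            hprodi.sub hi2
          have hi3 : Integrable (fun x => (m : ℂ) * conj (F (pathScale H (C ^ l) x))) μ :=
            hconji.const_mul _
          have hi123 : Integrable (fun x => F (pathScale H (C ^ k) x) *
              conj (F (pathScale H (C ^ l) x)) - m * F (pathScale H (C ^ k) x) -
              m * conj (F (pathScale H (C ^ l) x))) μ := hi12.sub hi3
          rw [integral_add hi123 (integrable_const _), integral_sub hi12 hi3,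
            integral_sub hprodi hi2, integral_const_mul, integral_const_mul, integral_conj,
            hF1 _ hk, hF1 _ hl, Complex.conj_ofReal]
          simp
        rw [hexpand, hF, hpair, ← Complex.ofReal_mul, ← Complex.ofReal_sub, Complex.norm_real]
        refine (hC _ ?_).1.le
        rw [le_div_iff₀ hk, ← pow_succ']
        exact pow_le_pow_right₀ hC1 hkl
      · have hk : 0 < C ^ k := pow_pos hCpos k
        conv_rhs => rw [← hμ.map_pathScale hK hk]
        rw [setIntegral_map hA (hFm.sub_const _).aestronglyMeasurable
          (measurable_pathScale H _).aemeasurable, hinv _ hk]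
    have h0 : ‖∫ x in A, (F x - m) ∂μ‖ ^ 2 ≤ 0 := le_of_forall_pos_le_add fun ε hε => by
      simpa using hsmall ε hε
    have h1 := pow_eq_zero_iff two_ne_zero |>.1 (le_antisymm h0 (sq_nonneg _))
    exact norm_eq_zero.1 h1
  have hFint : Integrable F μ :=
    Integrable.of_bound hFm.aestronglyMeasurable 1 (Eventually.of_forall fun x => (hFb x).le)
  rw [integral_sub hFint.integrableOn (integrable_const _), sub_eq_zero] at hgoal
  rw [hgoal]
  simp

/-- Zero-one law for events invariant under rescaling. -/
lemma IsGaussianPathLaw.measure_eq_zero_or_one [IsProbabilityMeasure μ]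
    (hμ : IsGaussianPathLaw K μ) (hK : IsSelfSimilarCov H K) (hsymm : ∀ s t, K s t = K t s)
    (hdecay : ∀ s t, Tendsto (fun c : ℝ≥0 => (c : ℝ) ^ (-H) * K s (c * t)) atTop (𝓝 0))
    {A : Set C(ℝ≥0, ℝ)} (hA : MeasurableSet A)
    (hinv : ∀ c : ℝ≥0, 0 < c → pathScale H c ⁻¹' A = A) : μ A = 0 ∨ μ A = 1 := by
  have : IsFiniteMeasure (μ A • μ) := μ.smul_finite (measure_ne_top μ A)
  have heq : μ.restrict A = μ A • μ := by
    refine ContinuousMap.measure_ext_of_charFun fun I a => ?_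
    rw [hμ.setIntegral_char_eq hK hsymm hdecay hA hinv, integral_smul_measure,
      Complex.real_smul, measureReal_def]
  have h := congrArg (fun ν : Measure C(ℝ≥0, ℝ) => ν A) heq
  simp only [Measure.restrict_apply_self, Measure.smul_apply, smul_eq_mul] at h
  by_cases h0 : μ A = 0
  · exact Or.inl h0
  · refine Or.inr ?_
    have h' : μ A * 1 = μ A * μ A := by rwa [mul_one]
    exact ((ENNReal.mul_right_inj h0 (measure_ne_top μ A)).1 h').symm

end Mixing

section Gaussian

/-- The sample path of a continuous process as an element of the space of continuous functions. -/
def samplePath {Ω : Type*} (X : ℝ → Ω → ℝ)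
    (hX : ∀ ω, ContinuousOn (fun t => X t ω) (Set.Ici 0)) (ω : Ω) : C(ℝ≥0, ℝ) :=
  ⟨fun t => X t ω, (hX ω).comp_continuous NNReal.continuous_coe fun t => t.2⟩

lemma runSup_fracInt_eq_samplePath {Ω : Type*} (θ : ℝ) {X : ℝ → Ω → ℝ}
    (hX : ∀ ω, ContinuousOn (fun t => X t ω) (Set.Ici 0)) (t : ℝ) (ω : Ω) :
    runSup (fracInt θ X) t ω = runSup (fracInt θ pathEval) t (samplePath X hX ω) := by
  rw [← one_mul (runSup (fracInt θ pathEval) t (samplePath X hX ω))]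
  refine runSup_fracInt_const_mul θ _ _ zero_le_one t _ _ fun u hu => ?_
  rw [one_mul]
  exact congrArg (X · ω) (Real.coe_toNNReal u hu).symm
variable {Ω : Type*} [MeasurableSpace Ω] {P : Measure Ω} {X : ℝ → Ω → ℝ} {α γ : ℝ}

lemma IsCenteredGaussianProcess.exists_map_sum_eq (hX : IsCenteredGaussianProcess P X)
    {ι : Type} [Fintype ι] (t : ι → ℝ) (a : ι → ℝ) :
    ∃ v : ℝ≥0, P.map (fun ω => ∑ i, a i * X (t i) ω) = gaussianReal 0 v := by
  obtain ⟨v, hv⟩ := hX _ (t ∘ (Fintype.equivFin ι).symm) (a ∘ (Fintype.equivFin ι).symm)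
  refine ⟨v, hv ▸ ?_⟩
  congr 1
  ext ω
  exact ((Fintype.equivFin ι).symm.sum_comp fun i => a i * X (t i) ω).symm

lemma IsCenteredGaussianProcess.exists_map_eq (hX : IsCenteredGaussianProcess P X) (t : ℝ) :
    ∃ v : ℝ≥0, P.map (X t) = gaussianReal 0 v := by
  simpa using hX.exists_map_sum_eq (fun _ : Unit => t) fun _ => 1

lemma IsCenteredGaussianProcess.aemeasurable (hX : IsCenteredGaussianProcess P X) (t : ℝ) :
    AEMeasurable (X t) P := by
  obtain ⟨v, hv⟩ := hX.exists_map_eq t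
  refine AEMeasurable.of_map_ne_zero ?_
  rw [hv]
  exact IsProbabilityMeasure.ne_zero _

lemma IsCenteredGaussianProcess.memLp_two (hX : IsCenteredGaussianProcess P X) (t : ℝ) :
    MemLp (X t) 2 P := by
  obtain ⟨v, hv⟩ := hX.exists_map_eq t
  have h : MemLp id 2 (P.map (X t)) := hv ▸ memLp_id_gaussianReal 2
  exact (memLp_map_measure_iff aestronglyMeasurable_id (hX.aemeasurable t)).1 h

lemma IsCenteredGaussianProcess.integral_exp_sum (hX : IsCenteredGaussianProcess P X)
    {ι : Type} [Fintype ι] (t : ι → ℝ) (a : ι → ℝ) :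
    ∫ ω, Complex.exp ((∑ i, a i * X (t i) ω : ℝ) * Complex.I) ∂P =
      (Real.exp (-(∑ i, ∑ j, a i * a j * ∫ ω, X (t i) ω * X (t j) ω ∂P) / 2) : ℝ) := by
  obtain ⟨v, hv⟩ := hX.exists_map_sum_eq t a
  have hm : AEMeasurable (fun ω => ∑ i, a i * X (t i) ω) P :=
    Finset.aemeasurable_fun_sum _ fun i _ => (hX.aemeasurable _).const_mul _
  have hvar : ∑ i, ∑ j, a i * a j * ∫ ω, X (t i) ω * X (t j) ω ∂P = v := by
    have h1 : ∫ x, x ^ 2 ∂(gaussianReal 0 v) = v := by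
      have := variance_fun_id_gaussianReal (μ := 0) (v := v)
      rw [variance_eq_integral (by fun_prop), integral_id_gaussianReal] at this
      simpa using this
    rw [← hv, integral_map hm (by fun_prop)] at h1
    rw [← h1]
    have hprod : ∀ i j, Integrable (fun ω => a i * a j * (X (t i) ω * X (t j) ω)) P :=
      fun i j => ((hX.memLp_two _).integrable_mul (hX.memLp_two _)).const_mul _
    have hsq : ∀ ω, (∑ i, a i * X (t i) ω) ^ 2 =
        ∑ i, ∑ j, a i * a j * (X (t i) ω * X (t j) ω) := fun ω => by
      rw [sq, Finset.sum_mul_sum]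
      exact Finset.sum_congr rfl fun i _ => Finset.sum_congr rfl fun j _ => by ring
    simp only [hsq]
    rw [integral_finsetSum _ fun i _ => integrable_finsetSum _ fun j _ => hprod i j]
    refine Finset.sum_congr rfl fun i _ => ?_
    rw [integral_finsetSum _ fun j _ => hprod i j]
    exact Finset.sum_congr rfl fun j _ => (integral_const_mul _ _).symm
  have hchar := charFun_gaussianReal (μ := 0) (v := v) 1
  rw [charFun_apply_real, ← hv, integral_map hm (by fun_prop)] at hchar
  rw [hvar]
  convert hchar using 1
  · simp
  · push_cast
    congr 1
    simp
    ring

lemma IsGFBM.continuousOn (hX : IsGFBM P α γ X) (ω : Ω) :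
    ContinuousOn (fun t => X t ω) (Set.Ici 0) :=
  hX.2.1 ω

lemma IsGFBM.integral_mul (hX : IsGFBM P α γ X) {s t : ℝ} (hs : 0 ≤ s) (ht : 0 ≤ t) :
    ∫ ω, X s ω * X t ω ∂P = gfbmCov α γ s t :=
  hX.2.2.2 s t hs ht

lemma IsGFBM.gfbmCov_eq_zero_of_self_eq_zero (hX : IsGFBM P α γ X) {s t : ℝ} (hs : 0 ≤ s)
    (ht : 0 ≤ t) (h : gfbmCov α γ s s = 0) : gfbmCov α γ s t = 0 := by
  have hL := hX.1.memLp_two s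
  rw [← hX.integral_mul hs hs] at h
  have h0 := (integral_eq_zero_iff_of_nonneg (fun ω => mul_self_nonneg (X s ω))
    (hL.integrable_mul hL)).1 h
  rw [← hX.integral_mul hs ht]
  refine integral_eq_zero_of_ae ?_
  filter_upwards [h0] with ω hω
  simp [mul_self_eq_zero.1 hω]

lemma gfbmCov_self_eq_zero_of_not_memLp {t : ℝ} (h : ¬ MemLp (gfbmKernel α γ t) 2) :
    gfbmCov α γ t t = 0 := by
  rw [memLp_two_iff_integrable_sq (measurable_gfbmKernel α γ t).aestronglyMeasurable] at h
  simp only [gfbmCov_eq_integral_kernel, ← sq]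
  exact integral_undef h

lemma IsGFBM.tendsto_gfbmCov_mul (hX : IsGFBM P α γ X) {s t : ℝ} (hs : 0 ≤ s) (ht : 0 ≤ t) :
    Tendsto (fun c : ℝ => c ^ (-(α - γ / 2 + 1 / 2)) * gfbmCov α γ s (c * t)) atTop (𝓝 0) := by
  by_cases hsL : MemLp (gfbmKernel α γ s) 2
  · by_cases htL : MemLp (gfbmKernel α γ t) 2
    · exact tendsto_gfbmCov_mul_of_memLp hsL htL
    · refine tendsto_const_nhds.congr' ?_
      filter_upwards [eventually_gt_atTop 0] with c hc
      rw [gfbmCov_comm, hX.gfbmCov_eq_zero_of_self_eq_zero (mul_nonneg hc.le ht) hs, mul_zero]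
      rw [gfbmCov_mul α γ t t hc, gfbmCov_self_eq_zero_of_not_memLp htL, mul_zero]
  · refine tendsto_const_nhds.congr' ?_
    filter_upwards [eventually_ge_atTop 0] with c hc
    rw [hX.gfbmCov_eq_zero_of_self_eq_zero hs (mul_nonneg hc ht)
      (gfbmCov_self_eq_zero_of_not_memLp hsL), mul_zero]

lemma IsGFBM.aemeasurable_samplePath (hX : IsGFBM P α γ X) :
    AEMeasurable (samplePath X hX.continuousOn) P :=
  ContinuousMap.aemeasurable_of_eval fun t => hX.1.aemeasurable t

lemma IsGFBM.isGaussianPathLaw (hX : IsGFBM P α γ X) :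
    IsGaussianPathLaw (fun s t => gfbmCov α γ s t) (P.map (samplePath X hX.continuousOn)) := by
  intro ι _ t a
  rw [integral_map hX.aemeasurable_samplePath
    (measurable_char_path_sum t a).aestronglyMeasurable]
  have h := hX.1.integral_exp_sum (fun i => (t i : ℝ)) a
  have hcov : ∀ i j, ∫ ω, X (t i) ω * X (t j) ω ∂P = gfbmCov α γ (t i) (t j) :=
    fun i j => hX.integral_mul (t i).2 (t j).2
  simp only [hcov] at h
  exact h

end Gaussian

end

/-- Zero-one law at infinity: the liminf in Chung's LIL at infinity is an a.s. constant
in `[0, ∞]` (possibly `0` or `∞`). -/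
theorem zeroOneLaw_infinity
    {Ω : Type*} [MeasurableSpace Ω] (P : Measure Ω) [IsProbabilityMeasure P]
    (γ α θ H β : ℝ) (hγ : γ ∈ Set.Ico (0:ℝ) 1)
    (hα : α ∈ Set.Ioo (-1/2 + γ/2) (1/2)) (hθ : 0 < θ)
    (hH : H = α - γ/2 + 1/2) (hβ : β = α + θ + 1/2)
    (X : ℝ → Ω → ℝ) (hX : IsGFBM P α γ X)
    (Y : ℝ → Ω → ℝ) (hY : Y = fracInt θ X) :
    ∃ κ₂' : ENNReal,
      ∀ᵐ ω ∂P, Filter.liminf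
        (fun t : ℝ => ENNReal.ofReal
          (runSup Y t ω * (Real.log (Real.log t)) ^ β / t ^ (H + θ)))
        Filter.atTop = κ₂' := by
  subst hY hH
  set H := α - γ / 2 + 1 / 2 with hH
  set μ := P.map (samplePath X hX.continuousOn) with hμ
  have hprob : IsProbabilityMeasure μ := Measure.isProbabilityMeasure_map hX.aemeasurable_samplePath
  have hK : IsSelfSimilarCov H fun s t => gfbmCov α γ s t := fun c s t hc => by
    push_cast
    exact gfbmCov_mul α γ s t (NNReal.coe_pos.2 hc)
  have hmeas := measurable_chungLiminf hθ β H
  have h01 : ∀ U : Set ENNReal, MeasurableSet U →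
      (∀ᵐ x ∂μ, chungLiminf θ β H x ∈ U) ∨ ∀ᵐ x ∂μ, chungLiminf θ β H x ∉ U := fun U hU => by
    rcases hX.isGaussianPathLaw.measure_eq_zero_or_one hK (fun s t => gfbmCov_comm α γ s t)
      (fun s t => by
        simp only [NNReal.coe_mul]
        exact (hX.tendsto_gfbmCov_mul s.2 t.2).comp (NNReal.tendsto_coe_atTop.2 tendsto_id))
      (hmeas hU) (fun c hc => by
        ext x
        simp only [Set.mem_preimage, chungLiminf_pathScale hθ β H hc]) with h | h
    · exact Or.inr (measure_eq_zero_iff_ae_notMem.1 h)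
    · exact Or.inl ((mem_ae_iff_prob_eq_one (hmeas hU)).2 h)
  obtain ⟨κ, hκ⟩ := exists_eventuallyEq_const_of_forall_separating MeasurableSet h01
  refine ⟨κ, ?_⟩
  filter_upwards [ae_of_ae_map hX.aemeasurable_samplePath hκ] with ω hω
  simp only [runSup_fracInt_eq_samplePath θ hX.continuousOn]
  exact hω
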